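/- Let X be a separable Hilbert space, let Ω be an open subset of X, and let u₀ : cl(Ω) → ℝ be a Lipschitz function such that lip(u₀, ∂Ω) < lip(u₀, cl(Ω)). Then for every ε > 0 there exists a function v : cl(Ω) → ℝ such that v is of class C^∞ on Ω, v is Lipschitz on cl(Ω) with lip(v, cl(Ω)) ≤ lip(u₀, cl(Ω)), v = u₀ on ∂Ω, and |u₀ − v| ≤ ε on cl(Ω). -/

import Mathlib

open Metric Set MeasureTheory

/-- `lipOn f s` is the Lipschitz constant of `f` on `s`:
the infimum of all `L > 0` such that `|f x - f y| ≤ L * dist x y` for all `x, y ∈ s`. -/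
noncomputable def lipOn {X : Type*} [PseudoMetricSpace X] (f : X → ℝ) (s : Set X) : ℝ :=
  sInf {L : ℝ | 0 < L ∧ ∀ x ∈ s, ∀ y ∈ s, |f x - f y| ≤ L * dist x y}

/-- `f` is `K`-Lipschitz on `s`. -/
def IsLipschitzWithOn {X : Type*} [PseudoMetricSpace X] (K : ℝ) (f : X → ℝ) (s : Set X) : Prop :=
  ∀ x ∈ s, ∀ y ∈ s, |f x - f y| ≤ K * dist x y

theorem exists_smooth_positivePart {δ : ℝ} (hδ : 0 < δ) :
    ∃ ω ω' : ℝ → ℝ, ContDiff ℝ (⊤ : ℕ∞) ω ∧ (∀ s, HasDerivAt ω (ω' s) s) ∧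
      (∀ s, 0 ≤ ω' s ∧ ω' s ≤ 1) ∧ (∀ s ≤ 0, ω s = 0) ∧ (∀ s, 0 ≤ ω s) ∧
      (∀ s, s - δ ≤ ω s) ∧ (∀ s, 0 ≤ s → ω s ≤ s) := by
  let σ : ℝ → ℝ := fun t => Real.smoothTransition (t / δ)
  have hσ : ContDiff ℝ (⊤ : ℕ∞) σ :=
    (Real.smoothTransition.contDiff (n := (⊤ : ℕ∞))).comp (contDiff_id.div_const δ)
  have hσc : Continuous σ := hσ.continuous
  have hd : ∀ s, HasDerivAt (fun s => ∫ t in (0 : ℝ)..s, σ t) (σ s) s := fun s =>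
    intervalIntegral.integral_hasDerivAt_right (hσc.intervalIntegrable _ _)
      (hσc.stronglyMeasurableAtFilter _ _) hσc.continuousAt
  have h01 : ∀ t, 0 ≤ σ t ∧ σ t ≤ 1 := fun t =>
    ⟨Real.smoothTransition.nonneg _, Real.smoothTransition.le_one _⟩
  have hz : ∀ s ≤ 0, ∫ t in (0 : ℝ)..s, σ t = 0 := by
    intro s hs
    rw [intervalIntegral.integral_congr (g := fun _ => (0 : ℝ))]
    · simp
    · intro t ht
      rw [uIcc_of_ge hs] at ht
      exact Real.smoothTransition.zero_of_nonpos (div_nonpos_of_nonpos_of_nonneg ht.2 hδ.le)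
  have hmono : Monotone fun s => ∫ t in (0 : ℝ)..s, σ t :=
    monotone_of_deriv_nonneg (fun s => (hd s).differentiableAt)
      fun s => (hd s).deriv ▸ (h01 s).1
  have hnn : ∀ s, 0 ≤ ∫ t in (0 : ℝ)..s, σ t := fun s => by
    rcases le_total s 0 with hs | hs
    · exact (hz s hs).ge
    · simpa using hmono hs
  refine ⟨fun s => ∫ t in (0 : ℝ)..s, σ t, σ, ?_, hd, h01, hz, hnn, ?_, ?_⟩
  · rw [contDiff_infty_iff_deriv]
    exact ⟨fun s => (hd s).differentiableAt, by rwa [show deriv _ = σ from funext fun s => (hd s).deriv]⟩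
  · intro s
    rcases le_total s δ with hs | hs
    · linarith [hnn s]
    · have h1 : ∫ t in (0 : ℝ)..s, σ t = (∫ t in (0 : ℝ)..δ, σ t) + ∫ t in δ..s, σ t :=
        (intervalIntegral.integral_add_adjacent_intervals (hσc.intervalIntegrable _ _)
          (hσc.intervalIntegrable _ _)).symm
      have h2 : ∫ t in δ..s, σ t = s - δ := by
        rw [intervalIntegral.integral_congr (g := fun _ => (1 : ℝ))]
        · simp
        · intro t ht
          rw [uIcc_of_le hs] at ht
          exact Real.smoothTransition.one_of_one_le ((one_le_div hδ).2 ht.1)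
      simp only
      linarith [hnn δ]
  · intro s hs
    calc ∫ t in (0 : ℝ)..s, σ t ≤ ∫ _ in (0 : ℝ)..s, (1 : ℝ) :=
          intervalIntegral.integral_mono hs (hσc.intervalIntegrable _ _)
            (by simp) fun t => (h01 t).2
      _ = s := by simp

theorem exists_bound_deriv_smoothTransition :
    ∃ A : ℝ, 0 < A ∧ ∀ t, |deriv Real.smoothTransition t| ≤ A := by
  have hc : Continuous (deriv Real.smoothTransition) :=
    (Real.smoothTransition.contDiff (n := 1)).continuous_deriv le_rfl
  obtain ⟨A, hA⟩ := (isCompact_Icc (a := (0 : ℝ)) (b := 1)).exists_bound_of_continuousOn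
    hc.continuousOn
  refine ⟨max A 1, by positivity, fun t => ?_⟩
  by_cases ht : t ∈ Icc (0 : ℝ) 1
  · exact (hA t ht).trans (le_max_left _ _)
  · have : deriv Real.smoothTransition t = 0 := by
      simp only [mem_Icc, not_and_or, not_le] at ht
      rcases ht with ht | ht
      · rw [Filter.EventuallyEq.deriv_eq (f := fun _ => (0 : ℝ))]
        · simp
        · filter_upwards [Iio_mem_nhds ht] with s hs
          exact Real.smoothTransition.zero_of_nonpos (le_of_lt hs)
      · rw [Filter.EventuallyEq.deriv_eq (f := fun _ => (1 : ℝ))]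
        · simp
        · filter_upwards [Ioi_mem_nhds ht] with s hs
          exact Real.smoothTransition.one_of_one_le (le_of_lt hs)
    rw [this]; simp

/-- Smooth bumps whose gradient is controlled by the inverse of the radius. -/
theorem exists_smooth_bump (X : Type*) [NormedAddCommGroup X] [InnerProductSpace ℝ X] :
    ∃ A : ℝ, 0 < A ∧ ∀ (c : X) (r : ℝ), 0 < r → ∃ β : X → ℝ,
      ContDiff ℝ (⊤ : ℕ∞) β ∧ (∀ x, 0 ≤ β x ∧ β x ≤ 1) ∧ (∀ x, ‖x - c‖ ≤ r → β x = 1) ∧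
      (∀ x, 2 * r ≤ ‖x - c‖ → β x = 0) ∧ ∀ x, ‖fderiv ℝ β x‖ ≤ A / r := by
  obtain ⟨A, hA, hb⟩ := exists_bound_deriv_smoothTransition
  refine ⟨4 * A, by positivity, fun c r hr => ?_⟩
  let β : X → ℝ := fun x => Real.smoothTransition (2 - ‖x - c‖ ^ 2 / r ^ 2)
  have hin : ContDiff ℝ (⊤ : ℕ∞) fun x : X => 2 - ‖x - c‖ ^ 2 / r ^ 2 :=
    contDiff_const.sub (((contDiff_id.sub contDiff_const).norm_sq ℝ).div_const _)
  have hβ : ContDiff ℝ (⊤ : ℕ∞) β := Real.smoothTransition.contDiff.comp hin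
  have h01 : ∀ x, 0 ≤ β x ∧ β x ≤ 1 := fun t =>
    ⟨Real.smoothTransition.nonneg _, Real.smoothTransition.le_one _⟩
  have h0 : ∀ x, 2 * r ≤ ‖x - c‖ → β x = 0 := fun x hx => by
    apply Real.smoothTransition.zero_of_nonpos
    have : 2 ≤ ‖x - c‖ ^ 2 / r ^ 2 := by
      rw [le_div_iff₀ (by positivity)]
      nlinarith
    linarith
  refine ⟨β, hβ, h01, fun x hx => ?_, h0, fun x => ?_⟩
  · apply Real.smoothTransition.one_of_one_le
    have : ‖x - c‖ ^ 2 / r ^ 2 ≤ 1 := by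
      rw [div_le_one (by positivity)]
      gcongr
    linarith
  · rcases le_or_gt (2 * r) ‖x - c‖ with hx | hx
    · have : IsLocalMin β x := Filter.Eventually.of_forall fun y => by
        rw [h0 x hx]; exact (h01 y).1
      rw [this.fderiv_eq_zero]
      simp; positivity
    · have hd : HasFDerivAt (fun x : X => 2 - ‖x - c‖ ^ 2 / r ^ 2)
          (-((r ^ 2)⁻¹ • (2 • innerSL ℝ (x - c)))) x := by
        have := (((hasFDerivAt_id (𝕜 := ℝ) x).sub_const c).norm_sq.const_mul ((r ^ 2)⁻¹)).const_sub 2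
        simpa [div_eq_inv_mul] using this
      have hσ : HasDerivAt Real.smoothTransition
          (deriv Real.smoothTransition (2 - ‖x - c‖ ^ 2 / r ^ 2)) (2 - ‖x - c‖ ^ 2 / r ^ 2) :=
        ((Real.smoothTransition.contDiff (n := 1)).differentiable one_ne_zero _).hasDerivAt
      have hc := hσ.comp_hasFDerivAt x hd
      rw [show fderiv ℝ β x = _ from hc.fderiv, norm_smul, norm_neg, norm_smul, Real.norm_eq_abs]
      have h2 : ‖(2 • innerSL ℝ (x - c) : X →L[ℝ] ℝ)‖ ≤ 4 * r := by
        rw [← Nat.cast_smul_eq_nsmul ℝ, norm_smul, innerSL_apply_norm]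
        norm_num; linarith
      have h3 : ‖(r ^ 2)⁻¹‖ = (r ^ 2)⁻¹ := by simp
      rw [h3]
      calc _ ≤ A * ((r ^ 2)⁻¹ * (4 * r)) := by
            gcongr
            exact hb _
        _ = 4 * A / r := by field_simp

/-- A smooth substitute for the running maximum of a sequence of smooth functions. -/
theorem exists_smooth_runningMax {E : Type*} [NormedAddCommGroup E] [NormedSpace ℝ E]
    {h : ℕ → E → ℝ} (hh : ∀ n, ContDiff ℝ (⊤ : ℕ∞) (h n)) {δ : ℝ} (hδ : 0 < δ) :
    ∃ T : ℕ → E → ℝ, (∀ n, ContDiff ℝ (⊤ : ℕ∞) (T n)) ∧ T 0 = h 0 ∧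
      (∀ n x, h n x - δ ≤ T n x) ∧ (∀ n x, T n x ≤ T (n + 1) x) ∧
      (∀ n x, h (n + 1) x ≤ T n x → T (n + 1) x = T n x) ∧
      (∀ x B, ∀ n, (∀ k ≤ n, h k x ≤ B) → T n x ≤ B) ∧
      (∀ x L, (∀ n, ‖fderiv ℝ (h n) x‖ ≤ L) → ∀ n, ‖fderiv ℝ (T n) x‖ ≤ L) := by
  obtain ⟨ω, ω', hω, hd, h01, hz, hnn, hge, hle⟩ := exists_smooth_positivePart hδ
  let T : ℕ → E → ℝ := fun n => Nat.rec (h 0) (fun n t x => t x + ω (h (n + 1) x - t x)) n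
  have hT : ∀ n, T (n + 1) = fun x => T n x + ω (h (n + 1) x - T n x) := fun n => rfl
  have hT0 : T 0 = h 0 := rfl
  clear_value T
  have hs : ∀ n, ContDiff ℝ (⊤ : ℕ∞) (T n) := by
    intro n
    induction n with
    | zero => rw [hT0]; exact hh 0
    | succ n ih => rw [hT]; exact ih.add (hω.comp ((hh _).sub ih))
  refine ⟨T, hs, hT0, ?_, ?_, ?_, ?_, ?_⟩
  · rintro (_ | n) x
    · rw [hT0]; linarith
    · rw [hT]; linarith [hge (h (n + 1) x - T n x)]
  · intro n x
    rw [hT]; linarith [hnn (h (n + 1) x - T n x)]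
  · intro n x hx
    rw [hT]
    simp [hz _ (sub_nonpos.2 hx)]
  · intro x B n
    induction n with
    | zero => intro hB; rw [hT0]; exact hB 0 le_rfl
    | succ n ih =>
      intro hB
      have h1 := ih fun k hk => hB k (hk.trans n.le_succ)
      have h2 := hB (n + 1) le_rfl
      rw [hT]
      rcases le_total (h (n + 1) x) (T n x) with hx | hx
      · simpa [hz _ (sub_nonpos.2 hx)] using h1
      · linarith [hle _ (sub_nonneg.2 hx)]
  · intro x L hL n
    induction n with
    | zero => rw [hT0]; exact hL 0
    | succ n ih =>
      have d1 := ((hs n).differentiable (by simp) x).hasFDerivAt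
      have d2 := ((hh (n + 1)).differentiable (by simp) x).hasFDerivAt
      have d3 := d1.add ((hd _).comp_hasFDerivAt x (d2.sub d1))
      rw [hT, show fderiv ℝ (fun x => T n x + ω (h (n + 1) x - T n x)) x = _ from d3.fderiv]
      obtain ⟨w0, w1⟩ := h01 (h (n + 1) x - T n x)
      set w := ω' (h (n + 1) x - T n x)
      have : fderiv ℝ (T n) x + w • (fderiv ℝ (h (n + 1)) x - fderiv ℝ (T n) x) =
          (1 - w) • fderiv ℝ (T n) x + w • fderiv ℝ (h (n + 1)) x := by module
      calc _ = ‖(1 - w) • fderiv ℝ (T n) x + w • fderiv ℝ (h (n + 1)) x‖ := by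
            rw [← this]; rfl
        _ ≤ (1 - w) * L + w * L := by
            refine (norm_add_le _ _).trans ?_
            rw [norm_smul, norm_smul, Real.norm_of_nonneg w0, Real.norm_of_nonneg (sub_nonneg.2 w1)]
            exact add_le_add (mul_le_mul_of_nonneg_left ih (sub_nonneg.2 w1))
              (mul_le_mul_of_nonneg_left (hL _) w0)
        _ = L := by ring

/-- A locally stationary sequence of functions agrees locally with its limit. -/
theorem exists_eventuallyEq_of_locally_stationary {α β : Type*} [TopologicalSpace α] [Nonempty β]
    {s : Set α} (V : ℕ → α → β)
    (hV : ∀ x ∈ s, ∃ N, ∀ᶠ y in nhds x, ∀ n ≥ N, V n y = V N y) :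
    ∃ v : α → β, ∀ x ∈ s, ∃ N, ∀ n ≥ N, v =ᶠ[nhds x] V n := by
  classical
  let v : α → β := fun y =>
    if h : ∃ N, ∀ n ≥ N, V n y = V N y then V h.choose y else Classical.arbitrary β
  have hv : ∀ y N, (∀ n ≥ N, V n y = V N y) → v y = V N y := by
    intro y N h
    have h' : ∃ N, ∀ n ≥ N, V n y = V N y := ⟨N, h⟩
    have hc := h'.choose_spec
    simp only [v, dif_pos h']
    rw [← hc (max N h'.choose) (le_max_right _ _), h _ (le_max_left _ _)]
  refine ⟨v, fun x hx => ?_⟩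
  obtain ⟨N, hN⟩ := hV x hx
  refine ⟨N, fun n hn => ?_⟩
  filter_upwards [hN] with y hy
  rw [hv y N hy, hy n hn]

/-- `f` has, up to arbitrarily small errors, first order expansions with a uniform quadratic
remainder. -/
def HasQuadraticExpansion {X : Type*} [NormedAddCommGroup X] [InnerProductSpace ℝ X]
    (C : ℝ) (f : X → ℝ) : Prop :=
  ∀ y : X, ∀ τ > 0, ∃ p : X, ∀ x, |f x - f y - inner ℝ p (x - y)| ≤ C * ‖x - y‖ ^ 2 + τ

theorem continuous_of_abs_sub_le {X : Type*} [NormedAddCommGroup X]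
    {f : X → ℝ} {K : ℝ} (hf : ∀ x y, |f x - f y| ≤ K * ‖x - y‖) :
    Continuous f :=
  (LipschitzWith.of_dist_le' (K := K) fun x y => by
    simpa only [dist_eq_norm, Real.norm_eq_abs] using hf x y).continuous

theorem norm_slope_le {X : Type*} [NormedAddCommGroup X] [InnerProductSpace ℝ X]
    {f : X → ℝ} {K C r : ℝ} (hr : 0 < r) (hK : 0 ≤ K) (hC : 0 ≤ C)
    (hf : ∀ x y, |f x - f y| ≤ K * ‖x - y‖) {y p : X}
    (hp : ∀ x, |f x - f y - inner ℝ p (x - y)| ≤ C * ‖x - y‖ ^ 2 + C * r ^ 2) :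
    ‖p‖ ≤ K + 2 * C * r := by
  rcases eq_or_ne p 0 with rfl | hp0
  · simp; positivity
  have hpn : 0 < ‖p‖ := norm_pos_iff.2 hp0
  have hn : ‖(r / ‖p‖) • p‖ = r := by
    rw [norm_smul, Real.norm_of_nonneg (by positivity)]; field_simp
  have h1 := hp (y + (r / ‖p‖) • p)
  have h2 := hf (y + (r / ‖p‖) • p) y
  rw [add_sub_cancel_left, hn] at h1 h2
  rw [inner_smul_right, real_inner_self_eq_norm_sq] at h1
  have h3 : r / ‖p‖ * ‖p‖ ^ 2 = r * ‖p‖ := by field_simp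
  rw [h3] at h1
  have h4 := (abs_le.1 h1).1
  have h5 := (abs_le.1 h2).2
  have : r * ‖p‖ ≤ r * (K + 2 * C * r) := by nlinarith
  exact le_of_mul_le_mul_left this hr

theorem exists_smooth_approx_on_ball {X : Type*} [NormedAddCommGroup X] [InnerProductSpace ℝ X]
    [TopologicalSpace.SeparableSpace X] {f : X → ℝ} {K C η : ℝ}
    (hK : 0 ≤ K) (hC : 0 < C) (hη : 0 < η) (hf : ∀ x y, |f x - f y| ≤ K * ‖x - y‖)
    (hq : HasQuadraticExpansion C f) :
    ∃ ρ > 0, ∀ x₀ : X, ∀ ε > 0, ∃ g : X → ℝ, (∀ x ∈ ball x₀ ρ, ContDiffAt ℝ (⊤ : ℕ∞) g x) ∧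
      ∀ x ∈ ball x₀ ρ, |g x - f x| ≤ ε ∧ ‖fderiv ℝ g x‖ ≤ K + η := by
  obtain ⟨A, hA, hbump⟩ := exists_smooth_bump X
  refine ⟨η / (8 * C), by positivity, fun x₀ ε hε => ?_⟩
  set ρ := η / (8 * C) with hρ
  have hρ0 : 0 < ρ := by positivity
  obtain ⟨r, hr, hr1, hr2⟩ : ∃ r > 0, 2 * C * r + 24 * C * r * A ≤ η / 2 ∧ 12 * C * r ^ 2 ≤ ε := by
    have t1 : Filter.Tendsto (fun r : ℝ => 2 * C * r + 24 * C * r * A) (nhds 0) (nhds 0) := by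
      have : Continuous (fun r : ℝ => 2 * C * r + 24 * C * r * A) := by fun_prop
      simpa using this.tendsto 0
    have t2 : Filter.Tendsto (fun r : ℝ => 12 * C * r ^ 2) (nhds 0) (nhds 0) := by
      have : Continuous (fun r : ℝ => 12 * C * r ^ 2) := by fun_prop
      simpa using this.tendsto 0
    have e1 := (t1.eventually (Iio_mem_nhds (half_pos hη))).filter_mono
      (nhdsWithin_le_nhds (s := Ioi 0))
    have e2 := (t2.eventually (Iio_mem_nhds hε)).filter_mono (nhdsWithin_le_nhds (s := Ioi 0))
    obtain ⟨r, ⟨h1, h2⟩, h3⟩ := ((e1.and e2).and self_mem_nhdsWithin).exists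
    exact ⟨r, h3, le_of_lt h1, le_of_lt h2⟩
  have := UniformSpace.secondCountable_of_separable X
  have : Nonempty (ball x₀ ρ) := ⟨⟨x₀, mem_ball_self hρ0⟩⟩
  let c : ℕ → X := fun n => (TopologicalSpace.denseSeq (ball x₀ ρ) n : X)
  have hcm : ∀ n, c n ∈ ball x₀ ρ := fun n => (TopologicalSpace.denseSeq (ball x₀ ρ) n).2
  have hcd : ∀ x ∈ ball x₀ ρ, ∃ n, ‖x - c n‖ < r := fun x hx => by
    obtain ⟨n, hn⟩ := (TopologicalSpace.denseRange_denseSeq (ball x₀ ρ)).exists_dist_lt ⟨x, hx⟩ hr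
    exact ⟨n, by simpa [Subtype.dist_eq, dist_eq_norm] using hn⟩
  clear_value c
  have hCr : 0 < C * r ^ 2 := by positivity
  choose p hp using fun n => hq (c n) (C * r ^ 2) hCr
  have hpn : ∀ n, ‖p n‖ ≤ K + 2 * C * r := fun n => norm_slope_le hr hK hC.le hf (hp n)
  choose b hbs hb01 hb1 hb0 hbd using fun n => hbump (c n) r hr
  -- `M n` is a smooth version of `max_{j < n} b j`.
  obtain ⟨M, hMs, hM0, hMge, hMmono, -, hMle, hMd⟩ :=
    exists_smooth_runningMax (h := fun n => Nat.casesOn n (fun _ => 0) b)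
      (by rintro (_ | n); exacts [contDiff_const, hbs n]) (δ := 1 / 4) (by norm_num)
  have hMd' : ∀ n x, ‖fderiv ℝ (M n) x‖ ≤ A / r := fun n x => by
    refine hMd x _ ?_ n
    rintro (_ | n)
    · simp; positivity
    · exact hbd n x
  have hMnn : ∀ n x, 0 ≤ M n x := fun n x => by
    have := monotone_nat_of_le_succ (f := fun n => M n x) (fun n => hMmono n x) n.zero_le
    simpa [hM0] using this
  let q : ℕ → X → ℝ := fun n x =>
    f (c n) + inner ℝ (p n) (x - c n) - C * ‖x - c n‖ ^ 2 - C * r ^ 2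
  have hqle : ∀ n x, q n x ≤ f x := fun n x => by
    have := (abs_le.1 (hp n x)).1
    simp only [q]; linarith
  have hqge : ∀ n x, ‖x - c n‖ < 2 * r → f x - 10 * (C * r ^ 2) ≤ q n x := fun n x hx => by
    have h1 := (abs_le.1 (hp n x)).2
    have h2 : C * ‖x - c n‖ ^ 2 ≤ C * (2 * r) ^ 2 := by gcongr
    simp only [q]; nlinarith
  have hqd : ∀ n x, HasFDerivAt (q n)
      (innerSL ℝ (p n) - C • (2 • innerSL ℝ (x - c n))) x := fun n x => by
    have h1 := (hasFDerivAt_id (𝕜 := ℝ) x).sub_const (c n)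
    have h2 := ((innerSL ℝ (p n)).hasFDerivAt.comp x h1).const_add (f (c n))
    have h3 := (h2.sub (h1.norm_sq.const_mul C)).sub_const (C * r ^ 2)
    exact (show HasFDerivAt (q n) _ x from h3).congr_fderiv (by ext v; simp)
  have hqs : ∀ n, ContDiff ℝ (⊤ : ℕ∞) (q n) := fun n => by
    have h1 : ContDiff ℝ (⊤ : ℕ∞) fun x : X => x - c n := contDiff_id.sub contDiff_const
    exact ((contDiff_const.add (contDiff_const.inner ℝ h1)).sub
      (contDiff_const.mul (h1.norm_sq ℝ))).sub contDiff_const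
  let h : ℕ → X → ℝ := fun n x => q n x + 12 * (C * r ^ 2) * (1 - 2 * M n x)
  have hhs : ∀ n, ContDiff ℝ (⊤ : ℕ∞) (h n) := fun n =>
    (hqs n).add (contDiff_const.mul (contDiff_const.sub (contDiff_const.mul (hMs n))))
  have hhd : ∀ n, ∀ x ∈ ball x₀ ρ, ‖fderiv ℝ (h n) x‖ ≤ K + η := fun n x hx => by
    have h1 := ((hMs n).differentiable (by simp) x).hasFDerivAt
    have h2 := (hqd n x).add (((h1.const_mul 2).const_sub 1).const_mul (12 * (C * r ^ 2)))
    rw [show fderiv ℝ (h n) x = _ from h2.fderiv]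
    have h3 : ‖x - c n‖ ≤ 2 * ρ := by
      rw [← dist_eq_norm]
      linarith [dist_triangle_right x (c n) x₀, mem_ball.1 hx, mem_ball.1 (hcm n)]
    have h4 : ‖innerSL ℝ (p n) - C • (2 • innerSL ℝ (x - c n))‖ ≤
        (K + 2 * C * r) + C * (2 * (2 * ρ)) := by
      refine (norm_sub_le _ _).trans ?_
      rw [← Nat.cast_smul_eq_nsmul ℝ, norm_smul, norm_smul, innerSL_apply_norm,
        innerSL_apply_norm, Real.norm_of_nonneg hC.le]
      gcongr
      · exact hpn n
      · simp
    have h5 : ‖(12 * (C * r ^ 2)) • -((2 : ℝ) • fderiv ℝ (M n) x)‖ ≤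
        12 * (C * r ^ 2) * (2 * (A / r)) := by
      rw [norm_smul, norm_neg, norm_smul, Real.norm_of_nonneg (by positivity)]
      gcongr
      · simp
      · exact hMd' n x
    have h6 : 12 * (C * r ^ 2) * (2 * (A / r)) = 24 * C * r * A := by field_simp; ring
    have h7 : C * (2 * (2 * ρ)) = η / 2 := by rw [hρ]; field_simp; ring
    refine (norm_add_le _ _).trans ?_
    linarith
  obtain ⟨T, hTs, -, hTge, hTmono, hTst, hTle, hTd⟩ := exists_smooth_runningMax hhs hCr
  have hTm : ∀ x, Monotone fun n => T n x := fun x => monotone_nat_of_le_succ (hTmono · x)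
  have hlow : ∀ x ∈ ball x₀ ρ, ∃ n, f x < T n x := fun x hx => by
    classical
    have hex : ∃ n, ‖x - c n‖ < 2 * r := by
      obtain ⟨n, hn⟩ := hcd x hx
      exact ⟨n, by linarith⟩
    refine ⟨Nat.find hex, ?_⟩
    have h1 := Nat.find_spec hex
    have h2 : M (Nat.find hex) x ≤ 0 := by
      refine hMle x 0 _ ?_
      rintro (_ | k) hk
      · exact le_rfl
      · exact (hb0 k x (not_lt.1 (Nat.find_min hex hk))).le
    have h3 := hTge (Nat.find hex) x
    have h4 := hqge _ x h1
    simp only [h] at h3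
    nlinarith
  have hkill : ∀ n x, ‖x - c n‖ < r → ∀ k > n, h k x ≤ f x := fun n x hx k hk => by
    have h1 : 1 - 1 / 4 ≤ M (n + 1) x := by
      have := hMge (n + 1) x
      simpa only [hb1 n x hx.le] using this
    have h2 : M (n + 1) x ≤ M k x :=
      monotone_nat_of_le_succ (f := fun n => M n x) (fun n => hMmono n x) hk
    have h3 := hqle k x
    simp only [h]
    nlinarith
  have hstat : ∀ x ∈ ball x₀ ρ, ∃ N, ∀ᶠ y in nhds x, ∀ n ≥ N, T n y = T N y := fun x hx => by
    obtain ⟨n₁, hn₁⟩ := hlow x hx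
    obtain ⟨n₂, hn₂⟩ := hcd x hx
    have hfc : Continuous f := continuous_of_abs_sub_le hf
    have e1 : ∀ᶠ y in nhds x, f y < T n₁ y :=
      hfc.continuousAt.eventually_lt (hTs n₁).continuous.continuousAt hn₁
    have e2 : ∀ᶠ y in nhds x, ‖y - c n₂‖ < r :=
      (continuous_id.sub continuous_const).norm.continuousAt.eventually_lt continuousAt_const hn₂
    refine ⟨max n₁ n₂, ?_⟩
    filter_upwards [e1, e2] with y hy1 hy2 n hn
    induction n, hn using Nat.le_induction with
    | base => rfl
    | succ n hn ih =>
      rw [hTst n y, ih]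
      have h1 := hkill n₂ y hy2 (n + 1) (by have := le_max_right n₁ n₂; omega)
      have h2 : T n₁ y ≤ T n y := hTm y ((le_max_left _ _).trans hn)
      linarith
  obtain ⟨g, hg⟩ := exists_eventuallyEq_of_locally_stationary T hstat
  refine ⟨g, fun x hx => ?_, fun x hx => ?_⟩
  · obtain ⟨N, hN⟩ := hg x hx
    exact (hTs N).contDiffAt.congr_of_eventuallyEq (hN N le_rfl)
  · obtain ⟨N, hN⟩ := hg x hx
    obtain ⟨n₁, hn₁⟩ := hlow x hx
    have h1 := hN (max N n₁) (le_max_left _ _)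
    have h2 : f x ≤ T (max N n₁) x := hn₁.le.trans (hTm x (le_max_right _ _))
    have h3 : T (max N n₁) x ≤ f x + 12 * (C * r ^ 2) := hTle x _ _ fun k _ => by
      have := hqle k x
      have := hMnn k x
      simp only [h]
      nlinarith
    refine ⟨?_, ?_⟩
    · rw [h1.eq_of_nhds, abs_le]
      constructor <;> nlinarith
    · rw [h1.fderiv_eq]
      exact hTd x _ (fun n => hhd n x hx) _

/-- Inf-convolution of `f` with the quadratic kernel `a‖w‖²`. -/
noncomputable def quadInfConv {X : Type*} [NormedAddCommGroup X] (a : ℝ) (f : X → ℝ) (x : X) : ℝ :=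
  ⨅ w : X, (f (x - w) + a * ‖w‖ ^ 2)

section QuadInfConv

variable {X : Type*} [NormedAddCommGroup X] {a K : ℝ} {f : X → ℝ}

theorem sub_le_add_quadratic (ha : 0 < a) (hf : ∀ x y, |f x - f y| ≤ K * ‖x - y‖) (x w : X) :
    f x - K ^ 2 / (4 * a) ≤ f (x - w) + a * ‖w‖ ^ 2 := by
  have h1 := (abs_le.1 (hf x (x - w))).2
  rw [sub_sub_cancel] at h1
  have h2 : K ^ 2 / (4 * a) + a * ‖w‖ ^ 2 - K * ‖w‖ = (K - 2 * a * ‖w‖) ^ 2 / (4 * a) := by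
    field_simp; ring
  have h3 : 0 ≤ (K - 2 * a * ‖w‖) ^ 2 / (4 * a) := by positivity
  linarith

theorem bddBelow_quadInfConv (ha : 0 < a) (hf : ∀ x y, |f x - f y| ≤ K * ‖x - y‖) (x : X) :
    BddBelow (range fun w : X => f (x - w) + a * ‖w‖ ^ 2) :=
  ⟨f x - K ^ 2 / (4 * a), by rintro _ ⟨w, rfl⟩; exact sub_le_add_quadratic ha hf x w⟩

theorem quadInfConv_le (ha : 0 < a) (hf : ∀ x y, |f x - f y| ≤ K * ‖x - y‖) (x z : X) :
    quadInfConv a f x ≤ f z + a * ‖x - z‖ ^ 2 := by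
  simpa [quadInfConv] using ciInf_le (bddBelow_quadInfConv ha hf x) (x - z)

theorem exists_lt_quadInfConv (a : ℝ) (f : X → ℝ) (x : X) {τ : ℝ} (hτ : 0 < τ) :
    ∃ z, f z + a * ‖x - z‖ ^ 2 < quadInfConv a f x + τ := by
  obtain ⟨w, hw⟩ := exists_lt_of_ciInf_lt (lt_add_of_pos_right (quadInfConv a f x) hτ)
  exact ⟨x - w, by simpa using hw⟩

theorem abs_quadInfConv_sub_le (ha : 0 < a) (hf : ∀ x y, |f x - f y| ≤ K * ‖x - y‖) (x : X) :
    |quadInfConv a f x - f x| ≤ K ^ 2 / (4 * a) := by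
  have h1 := quadInfConv_le ha hf x x
  have h2 : f x - K ^ 2 / (4 * a) ≤ quadInfConv a f x := le_ciInf (sub_le_add_quadratic ha hf x)
  have h3 : 0 ≤ K ^ 2 / (4 * a) := by positivity
  simp only [sub_self, norm_zero] at h1
  rw [abs_le]
  constructor <;> linarith

theorem quadInfConv_lipschitz (ha : 0 < a) (hf : ∀ x y, |f x - f y| ≤ K * ‖x - y‖) (x y : X) :
    |quadInfConv a f x - quadInfConv a f y| ≤ K * ‖x - y‖ := by
  have key : ∀ x y, quadInfConv a f x ≤ quadInfConv a f y + K * ‖x - y‖ := fun x y => by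
    rw [← sub_le_iff_le_add]
    refine le_ciInf fun w => ?_
    have h1 := ciInf_le (bddBelow_quadInfConv ha hf x) w
    have h2 := (abs_le.1 (hf (x - w) (y - w))).2
    rw [sub_sub_sub_cancel_right] at h2
    have h3 : quadInfConv a f x ≤ f (x - w) + a * ‖w‖ ^ 2 := h1
    linarith
  have h1 := key x y
  have h2 := key y x
  rw [norm_sub_rev] at h2
  rw [abs_le]
  constructor <;> linarith

theorem norm_add_sq_add_norm_sub_sq [InnerProductSpace ℝ X] (u h : X) :
    ‖u + h‖ ^ 2 + ‖u - h‖ ^ 2 = 2 * ‖u‖ ^ 2 + 2 * ‖h‖ ^ 2 := by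
  rw [norm_add_sq_real, norm_sub_sq_real]; ring

theorem quadInfConv_semiconcave [InnerProductSpace ℝ X] (ha : 0 < a)
    (hf : ∀ x y, |f x - f y| ≤ K * ‖x - y‖) (x h : X) :
    quadInfConv a f (x + h) + quadInfConv a f (x - h) ≤
      2 * quadInfConv a f x + 2 * a * ‖h‖ ^ 2 := by
  refine le_of_forall_pos_le_add fun τ hτ => ?_
  obtain ⟨z, hz⟩ := exists_lt_quadInfConv a f x (half_pos hτ)
  have h1 := quadInfConv_le ha hf (x + h) z
  have h2 := quadInfConv_le ha hf (x - h) z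
  have h3 := norm_add_sq_add_norm_sub_sq (x - z) h
  rw [sub_add_eq_add_sub, sub_right_comm] at h3
  nlinarith

end QuadInfConv

/-- Lasry–Lions regularization. -/
theorem exists_quadraticExpansion_approx {X : Type*} [NormedAddCommGroup X] [InnerProductSpace ℝ X]
    {f : X → ℝ} {K : ℝ}
    (hf : ∀ x y, |f x - f y| ≤ K * ‖x - y‖) {ε : ℝ} (hε : 0 < ε) :
    ∃ g : X → ℝ, (∀ x y, |g x - g y| ≤ K * ‖x - y‖) ∧ (∀ x, |g x - f x| ≤ ε) ∧
      ∃ C > 0, HasQuadraticExpansion C g := by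
  obtain ⟨a, ha, hKa⟩ : ∃ a > 0, K ^ 2 / (4 * a) ≤ ε / 2 := by
    refine ⟨(K ^ 2 + 1) / (2 * ε), by positivity, ?_⟩
    rw [div_le_iff₀ (by positivity)]
    field_simp
    nlinarith [sq_nonneg K]
  have ha2 : 0 < 2 * a := by positivity
  set F : X → ℝ := fun x => -quadInfConv a f x with hF
  have hFl : ∀ x y, |F x - F y| ≤ K * ‖x - y‖ := fun x y => by
    have := quadInfConv_lipschitz ha hf x y
    rw [abs_sub_comm] at this
    simpa only [hF, neg_sub_neg] using this
  refine ⟨fun x => -quadInfConv (2 * a) F x, fun x y => ?_, fun x => ?_, 3 * (2 * a), by positivity,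
    fun y τ hτ => ?_⟩
  · have := quadInfConv_lipschitz ha2 hFl x y
    rw [abs_sub_comm] at this
    simpa only [neg_sub_neg] using this
  · have h1 := abs_le.1 (abs_quadInfConv_sub_le ha hf x)
    have h2 := abs_le.1 (abs_quadInfConv_sub_le ha2 hFl x)
    have h3 : K ^ 2 / (4 * (2 * a)) ≤ K ^ 2 / (4 * a) := by gcongr; linarith
    simp only [hF] at h2
    rw [abs_le]
    constructor <;> linarith [h1.1, h1.2, h2.1, h2.2]
  · set G := quadInfConv (2 * a) F
    have hGmid : ∀ x h : X, 2 * G x ≤ G (x + h) + G (x - h) + 4 * a * ‖h‖ ^ 2 := by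
      intro x h
      refine le_of_forall_pos_le_add fun τ hτ => ?_
      obtain ⟨z₁, hz₁⟩ := exists_lt_quadInfConv (2 * a) F (x + h) (half_pos hτ)
      obtain ⟨z₂, hz₂⟩ := exists_lt_quadInfConv (2 * a) F (x - h) (half_pos hτ)
      set z := (2⁻¹ : ℝ) • (z₁ + z₂)
      set k := (2⁻¹ : ℝ) • (z₁ - z₂)
      have e1 : z₁ = z + k := by simp only [z, k]; module
      have e2 : z₂ = z - k := by simp only [z, k]; module
      have h1 := quadInfConv_semiconcave ha hf z k
      have h2 := quadInfConv_le ha2 hFl x z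
      have h3 := norm_add_sq_add_norm_sub_sq (x - z) (h - k)
      have h4 := norm_add_sq_add_norm_sub_sq h (h - k)
      rw [show x - z + (h - k) = x + h - z₁ by rw [e1]; abel,
        show x - z - (h - k) = x - h - z₂ by rw [e2]; abel] at h3
      rw [show h - (h - k) = k by abel] at h4
      rw [← e1, ← e2] at h1
      simp only [hF] at hz₁ hz₂ h2
      have h5 := sq_nonneg ‖h + (h - k)‖
      change 2 * quadInfConv (2 * a) F x ≤ _
      simp only [G, hF]
      nlinarith
    obtain ⟨z, hz⟩ := exists_lt_quadInfConv (2 * a) F y hτ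
    have hup : ∀ h : X, G (y + h) ≤ G y + τ + 2 * (2 * a) * inner ℝ (y - z) h +
        2 * a * ‖h‖ ^ 2 := by
      intro h
      have h1 := quadInfConv_le ha2 hFl (y + h) z
      rw [← sub_add_eq_add_sub, norm_add_sq_real] at h1
      change G (y + h) ≤ _ at h1
      change _ < G y + τ at hz
      nlinarith
    refine ⟨-((2 * (2 * a)) • (y - z)), fun x => ?_⟩
    have h1 := hup (x - y)
    have h2 := hup (-(x - y))
    have h3 := hGmid y (x - y)
    rw [add_sub_cancel] at h1 h3
    rw [inner_neg_right, norm_neg, ← sub_eq_add_neg] at h2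
    rw [inner_neg_left, real_inner_smul_left, abs_le]
    have h4 : 0 ≤ a * ‖x - y‖ ^ 2 := by positivity
    constructor <;> linarith

/-- Gluing of local smooth approximations of `f` on an open set, controlling the gradient. -/
theorem exists_smooth_gluing {X : Type*} [NormedAddCommGroup X] [InnerProductSpace ℝ X]
    [TopologicalSpace.SeparableSpace X] {Ω : Set X} (hΩ : IsOpen Ω)
    {f L τ : X → ℝ} (hτ : ContinuousOn τ Ω) (hτ0 : ∀ x ∈ Ω, 0 < τ x)
    (hloc : ∀ x ∈ Ω, ∃ r > 0, ∀ ε > 0, ∃ g : X → ℝ,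
      (∀ y ∈ ball x r, ContDiffAt ℝ (⊤ : ℕ∞) g y) ∧
      ∀ y ∈ ball x r, |g y - f y| ≤ ε ∧ ‖fderiv ℝ g y‖ ≤ L y) :
    ∃ v : X → ℝ, ∀ x ∈ Ω, ContDiffAt ℝ (⊤ : ℕ∞) v x ∧ |v x - f x| ≤ τ x ∧
      ‖fderiv ℝ v x‖ ≤ L x + τ x := by
  rcases Ω.eq_empty_or_nonempty with rfl | hne
  · exact ⟨0, by simp⟩
  have := UniformSpace.secondCountable_of_separable X
  have hloc' : ∀ x : Ω, ∃ r > 0, ∃ t > 0, (∀ y ∈ ball (x : X) r, t ≤ τ y) ∧ ∀ ε > 0, ∃ g : X → ℝ,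
      (∀ y ∈ ball (x : X) r, ContDiffAt ℝ (⊤ : ℕ∞) g y) ∧
      ∀ y ∈ ball (x : X) r, |g y - f y| ≤ ε ∧ ‖fderiv ℝ g y‖ ≤ L y := by
    rintro ⟨x, hx⟩
    obtain ⟨r, hr, h⟩ := hloc x hx
    have hc := hτ.continuousAt (hΩ.mem_nhds hx)
    obtain ⟨r', hr', h'⟩ := Metric.eventually_nhds_iff_ball.1
      (hc.eventually (lt_mem_nhds (half_lt_self (hτ0 x hx))))
    refine ⟨min r r', lt_min hr hr', τ x / 2, half_pos (hτ0 x hx), fun y hy => ?_, fun ε hε => ?_⟩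
    · exact (h' y (ball_subset_ball (min_le_right _ _) hy)).le
    · obtain ⟨g, hg1, hg2⟩ := h ε hε
      have hsub : ball x (min r r') ⊆ ball x r := ball_subset_ball (min_le_left _ _)
      exact ⟨g, fun y hy => hg1 y (hsub hy), fun y hy => hg2 y (hsub hy)⟩
  choose r hr t ht htτ hg using hloc'
  obtain ⟨c, hcov⟩ : ∃ c : ℕ → Ω, ∀ x ∈ Ω, ∃ j, ‖x - c j‖ < r (c j) / 3 := by
    obtain ⟨S, hS, hcov⟩ := TopologicalSpace.isOpen_iUnion_countable
      (fun x : Ω => ball (x : X) (r x / 3)) fun _ => isOpen_ball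
    have hmem : ∀ x ∈ Ω, ∃ z ∈ S, ‖x - z‖ < r z / 3 := fun x hx => by
      have : x ∈ ⋃ z ∈ S, ball (z : X) (r z / 3) := by
        rw [hcov]
        exact mem_iUnion.2 ⟨⟨x, hx⟩, mem_ball_self (by have := hr ⟨x, hx⟩; positivity)⟩
      simpa [dist_eq_norm] using this
    obtain ⟨x₀, hx₀⟩ := hne
    obtain ⟨z₀, hz₀, -⟩ := hmem x₀ hx₀
    obtain ⟨c, rfl⟩ := hS.exists_eq_range ⟨z₀, hz₀⟩
    exact ⟨c, fun x hx => by simpa using hmem x hx⟩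
  obtain ⟨A, hA, hbump⟩ := exists_smooth_bump X
  choose β hβs hβ01 hβ1 hβ0 hβd using fun n =>
    hbump (c n : X) (r (c n) / 3) (by have := hr (c n); positivity)
  let P : ℕ → X → ℝ := fun n x => ∏ j ∈ Finset.range n, (1 - β j x)
  have hP0 : P 0 = fun _ => 1 := by ext; simp [P]
  have hPs : ∀ n, P (n + 1) = fun x => P n x * (1 - β n x) := fun n => by
    ext x; simp [P, Finset.prod_range_succ]
  have hPz : ∀ x j, β j x = 1 → ∀ n ≥ j + 1, P n x = 0 := fun x j hj n hn =>
    Finset.prod_eq_zero (Finset.mem_range.2 (by omega : j < n)) (by simp [hj])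
  clear_value P
  have hPsm : ∀ n, ContDiff ℝ (⊤ : ℕ∞) (P n) := fun n => by
    induction n with
    | zero => rw [hP0]; exact contDiff_const
    | succ n ih => rw [hPs]; exact ih.mul (contDiff_const.sub (hβs n))
  have hP01 : ∀ n x, 0 ≤ P n x ∧ P n x ≤ 1 := fun n x => by
    induction n with
    | zero => simp [hP0]
    | succ n ih =>
      rw [hPs]
      have h1 := hβ01 n x
      exact ⟨mul_nonneg ih.1 (by linarith), mul_le_one₀ ih.2 (by linarith) (by linarith)⟩
  have hPd : ∀ n, ∃ m, ∀ x, ‖fderiv ℝ (P n) x‖ ≤ m := fun n => by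
    induction n with
    | zero => exact ⟨0, fun x => by simp [hP0]⟩
    | succ n ih =>
      obtain ⟨m, hm⟩ := ih
      refine ⟨m + A / (r (c n) / 3), fun x => ?_⟩
      have d1 := ((hPsm n).differentiable (by simp) x).hasFDerivAt
      have d2 := (((hβs n).differentiable (by simp) x).hasFDerivAt).const_sub 1
      rw [hPs, show fderiv ℝ (fun x => P n x * (1 - β n x)) x = _ from (d1.mul d2).fderiv]
      have h1 := hβ01 n x
      have h2 := hP01 n x
      refine (norm_add_le _ _).trans ?_
      rw [norm_smul, norm_smul, norm_neg, Real.norm_of_nonneg h2.1,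
        Real.norm_of_nonneg (sub_nonneg.2 h1.2)]
      have h3 : P n x * ‖fderiv ℝ (β n) x‖ ≤ 1 * (A / (r (c n) / 3)) :=
        mul_le_mul h2.2 (hβd n x) (norm_nonneg _) zero_le_one
      have h4 : (1 - β n x) * ‖fderiv ℝ (P n) x‖ ≤ 1 * m :=
        mul_le_mul (by linarith) (hm x) (norm_nonneg _) zero_le_one
      linarith
  let ψ : ℕ → X → ℝ := fun n x => P n x - P (n + 1) x
  have hψs : ∀ n, ContDiff ℝ (⊤ : ℕ∞) (ψ n) := fun n => (hPsm n).sub (hPsm (n + 1))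
  have hψ : ∀ n x, ψ n x = P n x * β n x := fun n x => by simp only [ψ, hPs]; ring
  have hψ0 : ∀ n x, 0 ≤ ψ n x := fun n x => by
    rw [hψ]; exact mul_nonneg (hP01 n x).1 (hβ01 n x).1
  have hψd : ∀ n, ∃ m, 0 ≤ m ∧ ∀ x, ‖fderiv ℝ (ψ n) x‖ ≤ m := fun n => by
    obtain ⟨m₁, h₁⟩ := hPd n
    obtain ⟨m₂, h₂⟩ := hPd (n + 1)
    have hb : ∀ x, ‖fderiv ℝ (ψ n) x‖ ≤ m₁ + m₂ := fun x => by
      have d1 := ((hPsm n).differentiable (by simp) x).hasFDerivAt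
      have d2 := ((hPsm (n + 1)).differentiable (by simp) x).hasFDerivAt
      rw [show fderiv ℝ (ψ n) x = _ from (d1.sub d2).fderiv]
      exact (norm_sub_le _ _).trans (add_le_add (h₁ x) (h₂ x))
    exact ⟨m₁ + m₂, (norm_nonneg _).trans (hb (c 0)), hb⟩
  have hψsum : ∀ N x, ∑ n ∈ Finset.range N, ψ n x = 1 - P N x := fun N x => by
    simp only [ψ]
    rw [Finset.sum_range_sub' (fun n => P n x), hP0]
  choose m hm0 hm using hψd
  have hε : ∀ n, 0 < t (c n) * (1 / 2) ^ (n + 1) / (1 + m n) := fun n => by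
    have := ht (c n)
    have := hm0 n
    positivity
  choose g hgs hgb using fun n => hg (c n) _ (hε n)
  have hεt : ∀ n, t (c n) * (1 / 2) ^ (n + 1) / (1 + m n) ≤ t (c n) := fun n => by
    have h1 := hm0 n
    have h2 := (ht (c n)).le
    rw [div_le_iff₀ (by positivity)]
    have h3 : ((1 : ℝ) / 2) ^ (n + 1) ≤ 1 := pow_le_one₀ (by norm_num) (by norm_num)
    nlinarith [mul_nonneg h2 h1, mul_le_mul_of_nonneg_left h3 h2]
  have hεm : ∀ n, t (c n) * (1 / 2) ^ (n + 1) / (1 + m n) * m n ≤ t (c n) * (1 / 2) ^ (n + 1) :=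
    fun n => by
    have h1 := hm0 n
    have h2 := (ht (c n)).le
    have h3 : (0 : ℝ) ≤ t (c n) * (1 / 2) ^ (n + 1) := by positivity
    rw [div_mul_eq_mul_div, div_le_iff₀ (by positivity)]
    nlinarith
  have hout : ∀ n x, x ∉ ball (c n : X) (r (c n)) → ψ n =ᶠ[nhds x] 0 := fun n x hx => by
    have h1 : 2 * (r (c n) / 3) < ‖x - c n‖ := by
      rw [mem_ball, dist_eq_norm, not_lt] at hx
      linarith [hr (c n)]
    have h2 : ∀ᶠ y : X in nhds x, 2 * (r (c n) / 3) < ‖y - (c n : X)‖ :=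
      continuousAt_const.eventually_lt (continuous_id.sub continuous_const).norm.continuousAt h1
    filter_upwards [h2] with y hy
    rw [hψ, hβ0 n y hy.le]; simp
  let V : ℕ → X → ℝ := fun N x => ∑ n ∈ Finset.range N, ψ n x * g n x
  have hnear : ∀ x ∈ Ω, ∃ j, ∀ᶠ y in nhds x, ∀ n ≥ j + 1, P n y = 0 := fun x hx => by
    obtain ⟨j, hj⟩ := hcov x hx
    have h2 : ∀ᶠ y : X in nhds x, ‖y - (c j : X)‖ < r (c j) / 3 :=
      (continuous_id.sub continuous_const).norm.continuousAt.eventually_lt continuousAt_const hj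
    exact ⟨j, h2.mono fun y hy => hPz y j (hβ1 j y hy.le)⟩
  have hstat : ∀ x ∈ Ω, ∃ N, ∀ᶠ y in nhds x, ∀ n ≥ N, V n y = V N y := fun x hx => by
    obtain ⟨j, hj⟩ := hnear x hx
    refine ⟨j + 1, hj.mono fun y hy n hn => ?_⟩
    symm
    refine Finset.sum_subset (Finset.range_mono hn) fun k _ hk => ?_
    rw [Finset.mem_range, not_lt] at hk
    rw [hψ, hy k hk]; ring
  obtain ⟨v, hv⟩ := exists_eventuallyEq_of_locally_stationary V hstat
  refine ⟨v, fun x hx => ?_⟩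
  obtain ⟨N₀, hN₀⟩ := hv x hx
  obtain ⟨j, hj⟩ := hnear x hx
  set N := max N₀ (j + 1)
  have hvN : v =ᶠ[nhds x] V N := hN₀ N (le_max_left _ _)
  have hPN : P N =ᶠ[nhds x] fun _ => 0 := hj.mono fun y hy => hy N (le_max_right _ _)
  have hsum1 : ∑ n ∈ Finset.range N, ψ n x = 1 := by rw [hψsum, hPN.eq_of_nhds, sub_zero]
  have hψx : ∀ n, HasFDerivAt (ψ n) (fderiv ℝ (ψ n) x) x := fun n =>
    ((hψs n).differentiable (by simp) x).hasFDerivAt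
  have hDsum : ∑ n ∈ Finset.range N, fderiv ℝ (ψ n) x = 0 := by
    have h1 : HasFDerivAt (fun y => ∑ n ∈ Finset.range N, ψ n y)
        (∑ n ∈ Finset.range N, fderiv ℝ (ψ n) x) x := HasFDerivAt.fun_sum fun n _ => hψx n
    have h2 : (fun y => ∑ n ∈ Finset.range N, ψ n y) =ᶠ[nhds x] fun _ => 1 := by
      filter_upwards [hPN] with y hy
      rw [hψsum, hy, sub_zero]
    exact h1.unique ((hasFDerivAt_const (1 : ℝ) x).congr_of_eventuallyEq h2)
  have hterm : ∀ n, HasFDerivAt (fun y => ψ n y * g n y)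
      (ψ n x • fderiv ℝ (g n) x + g n x • fderiv ℝ (ψ n) x) x := fun n => by
    by_cases hxn : x ∈ ball (c n : X) (r (c n))
    · exact (hψx n).mul ((hgs n x hxn).differentiableAt (by simp)).hasFDerivAt
    · have h0 := hout n x hxn
      have h1 : (fun y => ψ n y * g n y) =ᶠ[nhds x] fun _ => 0 := by
        filter_upwards [h0] with y hy
        simp [hy]
      rw [h0.fderiv_eq, h0.eq_of_nhds]
      simpa using (hasFDerivAt_const (0 : ℝ) x).congr_of_eventuallyEq h1
  refine ⟨?_, ?_, ?_⟩
  · refine ContDiffAt.congr_of_eventuallyEq (ContDiffAt.sum fun n _ => ?_) hvN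
    by_cases hxn : x ∈ ball (c n : X) (r (c n))
    · exact (hψs n).contDiffAt.mul (hgs n x hxn)
    · refine contDiffAt_const (c := (0 : ℝ)).congr_of_eventuallyEq ?_
      filter_upwards [hout n x hxn] with y hy
      simp [hy]
  · have h1 : V N x - f x = ∑ n ∈ Finset.range N, ψ n x * (g n x - f x) := by
      simp only [mul_sub, Finset.sum_sub_distrib, ← Finset.sum_mul, hsum1, one_mul, V]
    rw [hvN.eq_of_nhds, h1]
    calc _ ≤ ∑ n ∈ Finset.range N, |ψ n x * (g n x - f x)| := Finset.abs_sum_le_sum_abs _ _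
      _ ≤ ∑ n ∈ Finset.range N, ψ n x * τ x := by
          refine Finset.sum_le_sum fun n _ => ?_
          rw [abs_mul, abs_of_nonneg (hψ0 n x)]
          by_cases hxn : x ∈ ball (c n : X) (r (c n))
          · exact mul_le_mul_of_nonneg_left
              (((hgb n x hxn).1.trans (hεt n)).trans (htτ (c n) x hxn)) (hψ0 n x)
          · simp [(hout n x hxn).eq_of_nhds]
      _ = τ x := by rw [← Finset.sum_mul, hsum1, one_mul]
  · have h1 : HasFDerivAt (V N) (∑ n ∈ Finset.range N,
        (ψ n x • fderiv ℝ (g n) x + g n x • fderiv ℝ (ψ n) x)) x :=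
      HasFDerivAt.fun_sum fun n _ => hterm n
    have h2 : ∑ n ∈ Finset.range N, (ψ n x • fderiv ℝ (g n) x + g n x • fderiv ℝ (ψ n) x) =
        ∑ n ∈ Finset.range N, (ψ n x • fderiv ℝ (g n) x + (g n x - f x) • fderiv ℝ (ψ n) x) := by
      simp only [sub_smul, Finset.sum_add_distrib, Finset.sum_sub_distrib, ← Finset.smul_sum,
        hDsum, smul_zero, sub_zero]
    have hgeo : ∀ k : ℕ, ∑ n ∈ Finset.range k, ((1 : ℝ) / 2) ^ (n + 1) = 1 - (1 / 2) ^ k :=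
      fun k => by
      induction k with
      | zero => simp
      | succ k ih => rw [Finset.sum_range_succ, ih]; ring
    rw [hvN.fderiv_eq, h1.fderiv, h2]
    calc _ ≤ ∑ n ∈ Finset.range N,
          ‖ψ n x • fderiv ℝ (g n) x + (g n x - f x) • fderiv ℝ (ψ n) x‖ := norm_sum_le _ _
      _ ≤ ∑ n ∈ Finset.range N, (ψ n x * L x + (1 / 2) ^ (n + 1) * τ x) := by
          refine Finset.sum_le_sum fun n _ => ?_
          by_cases hxn : x ∈ ball (c n : X) (r (c n))
          · refine (norm_add_le _ _).trans (add_le_add ?_ ?_)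
            · rw [norm_smul, Real.norm_of_nonneg (hψ0 n x)]
              exact mul_le_mul_of_nonneg_left (hgb n x hxn).2 (hψ0 n x)
            · rw [norm_smul, Real.norm_eq_abs]
              calc _ ≤ t (c n) * (1 / 2) ^ (n + 1) / (1 + m n) * m n :=
                    mul_le_mul (hgb n x hxn).1 (hm n x) (norm_nonneg _) (hε n).le
                _ ≤ t (c n) * (1 / 2) ^ (n + 1) := hεm n
                _ ≤ (1 / 2) ^ (n + 1) * τ x := by
                    rw [mul_comm]
                    exact mul_le_mul_of_nonneg_left (htτ (c n) x hxn) (by positivity)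
          · rw [(hout n x hxn).fderiv_eq, (hout n x hxn).eq_of_nhds]
            have := (hτ0 x hx).le
            simp only [Pi.zero_apply, zero_smul, zero_mul, zero_add, fderiv_zero, smul_zero,
              norm_zero]
            positivity
      _ = L x + (1 - (1 / 2) ^ N) * τ x := by
          rw [Finset.sum_add_distrib, ← Finset.sum_mul, ← Finset.sum_mul, hsum1, hgeo, one_mul]
      _ ≤ L x + τ x := by
          have : (0 : ℝ) ≤ (1 / 2) ^ N * τ x := mul_nonneg (by positivity) (hτ0 x hx).le
          linarith

/-- Global smooth approximation of a Lipschitz function, almost preserving its constant. -/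
theorem exists_smooth_approx {X : Type*} [NormedAddCommGroup X] [InnerProductSpace ℝ X]
    [TopologicalSpace.SeparableSpace X] {f : X → ℝ} {K ε η : ℝ} (hK : 0 ≤ K)
    (hf : ∀ x y, |f x - f y| ≤ K * ‖x - y‖) (hε : 0 < ε) (hη : 0 < η) :
    ∃ g : X → ℝ, (∀ x, ContDiffAt ℝ (⊤ : ℕ∞) g x) ∧
      ∀ x, |g x - f x| ≤ ε ∧ ‖fderiv ℝ g x‖ ≤ K + η := by
  obtain ⟨g₁, hg₁, hgf, C, hC, hq⟩ := exists_quadraticExpansion_approx hf (half_pos hε)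
  obtain ⟨ρ, hρ, happ⟩ := exists_smooth_approx_on_ball hK hC (half_pos hη) hg₁ hq
  have hm : 0 < min (ε / 2) (η / 2) := lt_min (half_pos hε) (half_pos hη)
  obtain ⟨v, hv⟩ := exists_smooth_gluing isOpen_univ (f := g₁) (L := fun _ => K + η / 2)
    (τ := fun _ : X => min (ε / 2) (η / 2)) continuousOn_const (fun _ _ => hm)
    (fun x _ => ⟨ρ, hρ, happ x⟩)
  refine ⟨v, fun x => (hv x trivial).1, fun x => ⟨?_, ?_⟩⟩
  · have h1 := (hv x trivial).2.1
    have h2 := hgf x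
    have h3 := abs_sub_le (v x) (g₁ x) (f x)
    linarith [min_le_left (ε / 2) (η / 2)]
  · linarith [(hv x trivial).2.2, min_le_right (ε / 2) (η / 2)]

/-- A function on a normed space whose pointwise Lipschitz constants are at most `K` is
`K`-Lipschitz. -/
theorem abs_sub_le_of_eventually_le {E : Type*} [NormedAddCommGroup E] [NormedSpace ℝ E]
    {f : E → ℝ} {K : ℝ}
    (h : ∀ x, ∀ e > 0, ∀ᶠ y in nhds x, |f y - f x| ≤ (K + e) * ‖y - x‖) (x y : E) :
    |f x - f y| ≤ K * ‖x - y‖ := by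
  have hcont : Continuous f := continuous_iff_continuousAt.2 fun z => by
    rw [ContinuousAt, tendsto_iff_norm_sub_tendsto_zero]
    have h0 : Filter.Tendsto (fun y => (K + 1) * ‖y - z‖) (nhds z) (nhds 0) := by
      have : Continuous fun y => (K + 1) * ‖y - z‖ := by fun_prop
      simpa using this.tendsto z
    exact squeeze_zero' (Filter.Eventually.of_forall fun _ => norm_nonneg _) (h z 1 one_pos) h0
  rcases eq_or_ne x y with rfl | hxy
  · simp
  have hn : 0 < ‖x - y‖ := norm_sub_pos_iff.2 hxy
  let γ : ℝ → E := fun t => y + t • (x - y)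
  have hγ : Continuous γ := by fun_prop
  have hγs : ∀ s t, ‖γ s - γ t‖ = |s - t| * ‖x - y‖ := fun s t => by
    rw [← Real.norm_eq_abs, ← norm_smul]
    congr 1
    simp only [γ]
    module
  refine le_of_forall_pos_le_add fun δ hδ => ?_
  have key := image_norm_le_of_liminf_right_slope_norm_lt_deriv_boundary
    (f := fun t => f (γ t) - f y) (f' := fun _ => K * ‖x - y‖) (a := 0) (b := 1)
    (B := fun t => (K * ‖x - y‖ + δ) * t) (B' := fun _ => K * ‖x - y‖ + δ)
    (by fun_prop) ?_ (by simp [γ]) (by fun_prop)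
    (fun t _ => by simpa using ((hasDerivAt_id t).const_mul (K * ‖x - y‖ + δ)).hasDerivWithinAt)
    (fun t _ _ => by linarith) (right_mem_Icc.2 zero_le_one)
  · simpa [γ] using key
  · intro t _ r hr
    have he : 0 < (r - K * ‖x - y‖) / (2 * ‖x - y‖) := div_pos (by linarith) (by positivity)
    have h1 := (hγ.tendsto t).eventually (h (γ t) _ he)
    refine Filter.Eventually.frequently ?_
    filter_upwards [h1.filter_mono nhdsWithin_le_nhds, self_mem_nhdsWithin] with s hs hst
    have hst' : 0 < s - t := sub_pos.2 hst
    rw [hγs, abs_of_pos hst'] at hs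
    have h2 : (K + (r - K * ‖x - y‖) / (2 * ‖x - y‖)) * ((s - t) * ‖x - y‖)
        = (K * ‖x - y‖ + r) / 2 * (s - t) := by
      field_simp; ring
    rw [h2] at hs
    rw [slope_def_field, div_lt_iff₀ hst']
    have h3 := norm_sub_norm_le (f (γ s) - f y) (f (γ t) - f y)
    rw [sub_sub_sub_cancel_right] at h3
    simp only [Function.comp_apply, Real.norm_eq_abs] at h3 ⊢
    nlinarith

theorem abs_sub_mul_arctan_sub_le {c R s t : ℝ} (hc : 0 ≤ c) (hc1 : c ≤ 1) (hs : |s| ≤ R)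
    (ht : |t| ≤ R) :
    |(s - c * Real.arctan s) - (t - c * Real.arctan t)| ≤ (1 - c / (1 + R ^ 2)) * |s - t| := by
  have key := Convex.norm_image_sub_le_of_norm_hasDerivWithin_le
    (f := fun x => x - c * Real.arctan x) (f' := fun x => 1 - c * (1 / (1 + x ^ 2)))
    (s := Icc (-R) R) (C := 1 - c / (1 + R ^ 2)) (x := t) (y := s)
    (fun x _ => ((hasDerivAt_id x).sub
      ((Real.hasDerivAt_arctan x).const_mul c)).hasDerivWithinAt)
    (fun x hx => ?_) (convex_Icc _ _) (abs_le.1 ht) (abs_le.1 hs)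
  · simpa only [Real.norm_eq_abs] using key
  · have h1 : x ^ 2 ≤ R ^ 2 := sq_le_sq' hx.1 hx.2
    have h2 : 1 / (1 + x ^ 2) ≤ 1 := by
      rw [div_le_one (by positivity)]; nlinarith [sq_nonneg x]
    have h3 : 1 / (1 + R ^ 2) ≤ 1 / (1 + x ^ 2) := by gcongr
    have h4 : 0 ≤ 1 / (1 + x ^ 2) := by positivity
    rw [Real.norm_of_nonneg (by nlinarith), div_eq_mul_one_div c]
    nlinarith

/-- A `K`-Lipschitz function can be perturbed, keeping its values where it agrees with a function
of smaller Lipschitz constant, so that its local Lipschitz constants drop below `K`. -/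
theorem exists_locally_strict_perturbation {X : Type*} [NormedAddCommGroup X] {u w : X → ℝ}
    {K K₁ ε : ℝ} (hK₁ : 0 ≤ K₁) (hlt : K₁ < K) (hε : 0 < ε)
    (hu : ∀ x y, |u x - u y| ≤ K * ‖x - y‖) (hw : ∀ x y, |w x - w y| ≤ K₁ * ‖x - y‖) :
    ∃ u₁ e : X → ℝ, (∀ x y, |u₁ x - u₁ y| ≤ K * ‖x - y‖) ∧ (∀ x, |u₁ x - u x| ≤ ε) ∧
      (∀ x, u x = w x → u₁ x = u x) ∧ Continuous e ∧ (∀ x, 0 < e x) ∧ (∀ x, e x ≤ K) ∧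
      ∀ x, ∃ r > 0, ∀ y ∈ ball x r, ∀ z ∈ ball x r, |u₁ y - u₁ z| ≤ (K - e x) * ‖y - z‖ := by
  have hK : 0 < K := hK₁.trans_lt hlt
  set c : ℝ := min 1 (ε / 4) with hc
  have hc0 : 0 < c := lt_min one_pos (by positivity)
  have hc1 : c ≤ 1 := min_le_left _ _
  have hcε : c ≤ ε / 4 := min_le_right _ _
  let p : X → ℝ := fun x => u x - c * Real.arctan (u x)
  have hp : ∀ x, |p x - u x| ≤ ε / 2 := fun x => by
    have h1 : |Real.arctan (u x)| ≤ 2 := by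
      rw [abs_le]
      constructor <;> linarith [Real.arctan_lt_pi_div_two (u x),
        Real.neg_pi_div_two_lt_arctan (u x), Real.pi_lt_four]
    have h2 : p x - u x = -(c * Real.arctan (u x)) := by simp only [p]; ring
    rw [h2, abs_neg, abs_mul, abs_of_pos hc0]
    nlinarith [abs_nonneg (Real.arctan (u x))]
  have hlip : ∀ l x y, |p x - p y| ≤ l → |w x - w y| ≤ l →
      |max (min (w x) (p x + ε / 2)) (p x - ε / 2) -
        max (min (w y) (p y + ε / 2)) (p y - ε / 2)| ≤ l := fun l x y h1 h2 => by
    refine (abs_max_sub_max_le_max _ _ _ _).trans (max_le ?_ (by simpa using h1))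
    exact (abs_min_sub_min_le_max _ _ _ _).trans (max_le h2 (by simpa using h1))
  have hp1 : ∀ x y R, |u x| ≤ R → |u y| ≤ R →
      |p x - p y| ≤ (K - K * c / (1 + R ^ 2)) * ‖x - y‖ := fun x y R hx hy => by
    have h1 := abs_sub_mul_arctan_sub_le hc0.le hc1 hx hy
    have h2 : 0 ≤ 1 - c / (1 + R ^ 2) := by
      rw [sub_nonneg, div_le_one (by positivity)]; nlinarith [sq_nonneg R]
    have h3 := mul_le_mul_of_nonneg_left (hu x y) h2
    calc _ ≤ _ := h1.trans h3
      _ = _ := by ring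
  have hucont : Continuous u := continuous_of_abs_sub_le hu
  refine ⟨fun x => max (min (w x) (p x + ε / 2)) (p x - ε / 2),
    fun x => min (K - K₁) (K * c / (1 + (|u x| + 1) ^ 2)), fun x y => hlip _ x y ?_ ?_,
    fun x => ?_, fun x hx => ?_, ?_, fun x => lt_min (by linarith) (by positivity),
    fun x => (min_le_left _ _).trans (by linarith), fun x => ?_⟩
  · refine (hp1 x y _ (le_max_left _ _) (le_max_right _ _)).trans ?_
    gcongr
    have : 0 ≤ K * c / (1 + (max |u x| |u y|) ^ 2) := by positivity
    linarith
  · exact (hw x y).trans (by gcongr)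
  · have h1 := abs_le.1 (hp x)
    have h2 : max (min (w x) (p x + ε / 2)) (p x - ε / 2) ≤ p x + ε / 2 :=
      max_le (min_le_right _ _) (by linarith)
    have h3 := le_max_right (min (w x) (p x + ε / 2)) (p x - ε / 2)
    rw [abs_le]
    constructor <;> linarith
  · have h1 := abs_le.1 (hp x)
    simp only [← hx]
    rw [min_eq_left (by linarith), max_eq_left (by linarith)]
  · refine continuous_const.min (continuous_const.div (by fun_prop) fun x => by positivity)
  · refine ⟨1 / K, by positivity, fun y hy z hz => hlip _ y z ?_ ?_⟩
    · have hb : ∀ y ∈ ball x (1 / K), |u y| ≤ |u x| + 1 := fun y hy => by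
        rw [mem_ball, dist_eq_norm, lt_div_iff₀ hK] at hy
        have h1 := hu y x
        have h2 := abs_sub_abs_le_abs_sub (u y) (u x)
        linarith
      refine (hp1 y z _ (hb y hy) (hb z hz)).trans ?_
      gcongr
      exact min_le_right _ _
    · refine (hw y z).trans ?_
      gcongr
      linarith [min_le_left (K - K₁) (K * c / (1 + (|u x| + 1) ^ 2))]

theorem exists_lipschitz_extension {X : Type*} [NormedAddCommGroup X] {f : X → ℝ} {s : Set X}
    {K : ℝ} (hK : 0 ≤ K) (hf : IsLipschitzWithOn K f s) :
    ∃ g : X → ℝ, (∀ x y, |g x - g y| ≤ K * ‖x - y‖) ∧ EqOn f g s := by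
  have h : LipschitzOnWith ⟨K, hK⟩ f s := LipschitzOnWith.of_dist_le_mul hf
  obtain ⟨g, hg, hfg⟩ := h.extend_real
  exact ⟨g, fun x y => by
    have := hg.dist_le_mul x y
    rwa [dist_eq_norm, dist_eq_norm, Real.norm_eq_abs] at this, hfg⟩

theorem exists_continuous_le_sq_norm_sub {X : Type*} [NormedAddCommGroup X] {Ω : Set X}
    (hΩ : IsOpen Ω) :
    ∃ θ : X → ℝ, Continuous θ ∧ (∀ x ∈ Ω, 0 < θ x) ∧ ∀ x, ∀ y ∉ Ω, θ x ≤ ‖x - y‖ ^ 2 := by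
  rcases Ωᶜ.eq_empty_or_nonempty with h | h
  · exact ⟨fun _ => 1, continuous_const, fun _ _ => one_pos, fun x y hy =>
      absurd (show y ∈ Ωᶜ from hy) (by simp [h])⟩
  · refine ⟨fun x => infDist x Ωᶜ ^ 2, by fun_prop, fun x hx => ?_, fun x y hy => ?_⟩
    · have := (hΩ.isClosed_compl.notMem_iff_infDist_pos h).1 (fun hx' => hx' hx)
      positivity
    · have h1 := infDist_le_dist_of_mem (x := x) (show y ∈ Ωᶜ from hy)
      rw [dist_eq_norm] at h1
      exact pow_le_pow_left₀ infDist_nonneg h1 2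

/-- Smoothing on an open set `Ω` of a `K`-Lipschitz function without increasing `K` nor changing
the function off `Ω`, when it has local Lipschitz constants less than `K`. -/
theorem exists_smooth_approx_of_locally_strict {X : Type*} [NormedAddCommGroup X]
    [InnerProductSpace ℝ X] [TopologicalSpace.SeparableSpace X] {Ω : Set X} (hΩ : IsOpen Ω)
    {u e : X → ℝ} {K ε : ℝ} (hε : 0 < ε) (hu : ∀ x y, |u x - u y| ≤ K * ‖x - y‖)
    (he : Continuous e) (he0 : ∀ x, 0 < e x) (heK : ∀ x, e x ≤ K)
    (hloc : ∀ x, ∃ r > 0, ∀ y ∈ ball x r, ∀ z ∈ ball x r,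
      |u y - u z| ≤ (K - e x) * ‖y - z‖) :
    ∃ v : X → ℝ, ContDiffOn ℝ (⊤ : ℕ∞) v Ω ∧ (∀ x y, |v x - v y| ≤ K * ‖x - y‖) ∧
      (∀ x ∉ Ω, v x = u x) ∧ ∀ x, |v x - u x| ≤ ε := by
  classical
  obtain ⟨θ, hθ, hθ0, hθΩ⟩ := exists_continuous_le_sq_norm_sub hΩ
  have hτ : Continuous fun x => min (e x / 2) (min (θ x) ε) := by fun_prop
  obtain ⟨v, hv⟩ := exists_smooth_gluing hΩ (f := u) (L := fun x => K - e x / 2) hτ.continuousOn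
    (fun x hx => lt_min (half_pos (he0 x)) (lt_min (hθ0 x hx) hε)) fun x hx => by
      obtain ⟨r, hr, hur⟩ := hloc x
      have hev : ∀ᶠ y in nhds x, e y < 3 / 2 * e x :=
        he.continuousAt.eventually_lt continuousAt_const (by linarith [he0 x])
      obtain ⟨s, hs, hes⟩ := Metric.eventually_nhds_iff_ball.1 hev
      obtain ⟨g, hg, hgu⟩ := exists_lipschitz_extension (s := ball x r) (sub_nonneg.2 (heK x))
        (f := u) fun y hy z hz => by simpa only [dist_eq_norm] using hur y hy z hz
      refine ⟨min r s, lt_min hr hs, fun δ hδ => ?_⟩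
      obtain ⟨h, hh, hhg⟩ := exists_smooth_approx (sub_nonneg.2 (heK x)) hg hδ
        (show 0 < e x / 4 by linarith [he0 x])
      refine ⟨h, fun y _ => hh y, fun y hy => ⟨?_, ?_⟩⟩
      · rw [hgu (ball_subset_ball (min_le_left _ _) hy)]
        exact (hhg y).1
      · linarith [(hhg y).2, hes y (ball_subset_ball (min_le_right _ _) hy)]
  have hτe : ∀ x ∈ Ω, ‖fderiv ℝ v x‖ ≤ K := fun x hx => by
    linarith [(hv x hx).2.2, min_le_left (e x / 2) (min (θ x) ε)]
  have hτθ : ∀ x ∈ Ω, |v x - u x| ≤ θ x := fun x hx =>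
    (hv x hx).2.1.trans ((min_le_right _ _).trans (min_le_left _ _))
  have hτε : ∀ x ∈ Ω, |v x - u x| ≤ ε := fun x hx =>
    (hv x hx).2.1.trans ((min_le_right _ _).trans (min_le_right _ _))
  have hin : ∀ x ∈ Ω, Ω.piecewise v u =ᶠ[nhds x] v := fun x hx => by
    filter_upwards [hΩ.mem_nhds hx] with y hy
    exact piecewise_eq_of_mem _ _ _ hy
  refine ⟨Ω.piecewise v u,
    fun x hx => (((hv x hx).1.congr_of_eventuallyEq (hin x hx))).contDiffWithinAt,
    abs_sub_le_of_eventually_le fun x δ hδ => ?_,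
    fun x hx => piecewise_eq_of_notMem _ _ _ hx, fun x => ?_⟩
  · by_cases hx : x ∈ Ω
    · have hd : HasFDerivAt (Ω.piecewise v u) (fderiv ℝ v x) x :=
        (((hv x hx).1.differentiableAt (by simp)).hasFDerivAt).congr_of_eventuallyEq (hin x hx)
      filter_upwards [hd.isLittleO.def hδ] with y hy
      have h1 := (fderiv ℝ v x).le_of_opNorm_le (hτe x hx) (y - x)
      have h2 := abs_add_le (Ω.piecewise v u y - Ω.piecewise v u x - fderiv ℝ v x (y - x))
        (fderiv ℝ v x (y - x))
      rw [sub_add_cancel] at h2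
      rw [Real.norm_eq_abs] at hy h1
      linarith
    · filter_upwards [ball_mem_nhds x hδ] with y hy
      rw [mem_ball, dist_eq_norm] at hy
      rw [piecewise_eq_of_notMem _ _ _ hx]
      have h1 := hu y x
      by_cases hy' : y ∈ Ω
      · rw [piecewise_eq_of_mem _ _ _ hy']
        have h2 := (hτθ y hy').trans (hθΩ y x hx)
        have h3 := abs_sub_le (v y) (u y) (u x)
        nlinarith [norm_nonneg (y - x)]
      · rw [piecewise_eq_of_notMem _ _ _ hy']
        nlinarith [norm_nonneg (y - x)]
  · by_cases hx : x ∈ Ω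
    · rw [piecewise_eq_of_mem _ _ _ hx]
      exact hτε x hx
    · rw [piecewise_eq_of_notMem _ _ _ hx, sub_self, abs_zero]
      exact hε.le

section LipOn

variable {X : Type*} [PseudoMetricSpace X] {f : X → ℝ} {s : Set X}

theorem lipOn_nonneg : 0 ≤ lipOn f s :=
  Real.sInf_nonneg fun _ h => h.1.le

theorem lipOn_le {K : ℝ} (hK : 0 < K) (h : IsLipschitzWithOn K f s) : lipOn f s ≤ K :=
  csInf_le ⟨0, fun _ h => h.1.le⟩ ⟨hK, h⟩

theorem exists_isLipschitzWithOn_lt {K L : ℝ} (h : IsLipschitzWithOn K f s) (hL : lipOn f s < L) :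
    ∃ M, 0 < M ∧ M < L ∧ IsLipschitzWithOn M f s := by
  have hne : {L : ℝ | 0 < L ∧ ∀ x ∈ s, ∀ y ∈ s, |f x - f y| ≤ L * dist x y}.Nonempty :=
    ⟨max K 1, by positivity, fun x hx y hy => (h x hx y hy).trans (by gcongr; exact le_max_left _ _)⟩
  obtain ⟨M, hM, hML⟩ := exists_lt_of_csInf_lt hne hL
  exact ⟨M, hM.1, hML, hM.2⟩

theorem isLipschitzWithOn_lipOn {K : ℝ} (h : IsLipschitzWithOn K f s) :
    IsLipschitzWithOn (lipOn f s) f s := fun x hx y hy => by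
  refine le_of_forall_pos_le_add fun δ hδ => ?_
  obtain ⟨M, -, hM, hMf⟩ := exists_isLipschitzWithOn_lt h
    (lt_add_of_pos_right (lipOn f s) (show 0 < δ / (dist x y + 1) by positivity))
  have h1 := hMf x hx y hy
  have h2 : δ / (dist x y + 1) * dist x y ≤ δ := by
    rw [div_mul_eq_mul_div, div_le_iff₀ (by positivity)]
    linarith
  nlinarith [dist_nonneg (x := x) (y := y)]

end LipOn

/-- Approximation of Lipschitz functions preserving boundary values and the Lipschitz
constant, by functions of class `C^∞`, in a separable Hilbert space. -/
theorem stmt_1 {X : Type*} [NormedAddCommGroup X] [InnerProductSpace ℝ X] [CompleteSpace X]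
    [TopologicalSpace.SeparableSpace X]
    (Ω : Set X) (hΩ : IsOpen Ω) (u₀ : X → ℝ)
    (hu₀ : ∃ K : ℝ, IsLipschitzWithOn K u₀ (closure Ω))
    (hlt : lipOn u₀ (frontier Ω) < lipOn u₀ (closure Ω))
    (ε : ℝ) (hε : 0 < ε) :
    ∃ v : X → ℝ,
      ContDiffOn ℝ (⊤ : ℕ∞) v Ω ∧
      IsLipschitzWithOn (lipOn u₀ (closure Ω)) v (closure Ω) ∧
      lipOn v (closure Ω) ≤ lipOn u₀ (closure Ω) ∧
      (∀ x ∈ frontier Ω, v x = u₀ x) ∧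
      (∀ x ∈ closure Ω, |u₀ x - v x| ≤ ε) := by
  obtain ⟨K₀, hK₀⟩ := hu₀
  have hfr : frontier Ω ⊆ closure Ω := frontier_subset_closure
  have hK := lipOn_nonneg.trans_lt hlt
  obtain ⟨K₁, hK₁, hK₁K, hK₁u⟩ := exists_isLipschitzWithOn_lt
    (fun x hx y hy => hK₀ x (hfr hx) y (hfr hy)) hlt
  obtain ⟨u, hu, huu₀⟩ := exists_lipschitz_extension hK.le (isLipschitzWithOn_lipOn hK₀)
  obtain ⟨w, hw, hwu₀⟩ := exists_lipschitz_extension hK₁.le hK₁u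
  obtain ⟨u₁, e, hu₁, hu₁u, hu₁w, he, he0, heK, hloc⟩ :=
    exists_locally_strict_perturbation hK₁.le hK₁K (half_pos hε) hu hw
  obtain ⟨v, hv, hvK, hvu, hvε⟩ :=
    exists_smooth_approx_of_locally_strict hΩ (half_pos hε) hu₁ he he0 heK hloc
  have hvL : IsLipschitzWithOn (lipOn u₀ (closure Ω)) v (closure Ω) := fun x _ y _ => by
    simpa only [dist_eq_norm] using hvK x y
  refine ⟨v, hv, hvL, lipOn_le hK hvL, fun x hx => ?_, fun x hx => ?_⟩
  · have h1 : x ∉ Ω := fun h => hΩ.inter_frontier_eq.subset ⟨h, hx⟩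
    rw [hvu x h1, hu₁w x ((huu₀ (hfr hx)).symm.trans (hwu₀ hx)), ← huu₀ (hfr hx)]
  · rw [huu₀ hx, abs_sub_comm]
    linarith [abs_sub_le (v x) (u₁ x) (u x), hvε x, hu₁u x]
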